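/- Let 𝕂 be an infinite field, N a finite set, Γ a principally regular symmetric matrix over 𝕂 indexed by N with G = CIS(Γ), and let L be a finite set disjoint from N. Then the set {(ij|K'∪L) ∈ A_{N∪L} : i, j ∈ N, K' ⊆ N∖{i,j}, (ij|K') ∈ G} is algebraically realizable over 𝕂, i.e. equals CIS(Φ) for some principally regular symmetric matrix Φ over 𝕂 indexed by N ∪ L. Moreover, if 𝕂 is linearly ordered, then for every principally regular symmetric matrix Λ over 𝕂 indexed by L and every ε > 0 in 𝕂, such a Φ can be chosen with every entry differing by less than ε from the corresponding entry of the block-diagonal matrix with diagonal blocks Γ and Λ. -/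

import Mathlib

open scoped symmDiff

abbrev CIStmt (N : Type*) := Sym2 N × Finset N

def CIStmt.proper {N : Type*} (s : CIStmt N) : Prop :=
  ¬ s.1.IsDiag ∧ ∀ i ∈ s.1, i ∉ s.2

variable {N : Type*} [DecidableEq N]

def pminor {R : Type*} [CommRing R] (M : Matrix N N R) (S : Finset N) : R :=
  (M.submatrix (fun a : S => (a : N)) (fun a : S => (a : N))).det

def apminor {R : Type*} [CommRing R] (M : Matrix N N R) (i j : N) (K : Finset N) : R :=
  (Matrix.of fun a b : Unit ⊕ ↥K =>
      M (Sum.elim (fun _ => i) (fun k => (k : N)) a)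
        (Sum.elim (fun _ => j) (fun k => (k : N)) b)).det

def PrinReg {R : Type*} [CommRing R] (M : Matrix N N R) : Prop :=
  ∀ S : Finset N, pminor M S ≠ 0

def PosDefMinors {R : Type*} [Field R] [LinearOrder R] [IsStrictOrderedRing R] (M : Matrix N N R) : Prop :=
  ∀ S : Finset N, 0 < pminor M S

def CIS {R : Type*} [CommRing R] (M : Matrix N N R) : Set (CIStmt N) :=
  {s | s.proper ∧ ∀ i j : N, s.1 = s(i, j) → apminor M i j s.2 = 0}

def IsGaussoid (G : Set (CIStmt N)) : Prop :=
  (∀ s ∈ G, s.proper) ∧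
  ∀ i j k : N, ∀ L : Finset N,
    i ≠ j → i ≠ k → j ≠ k → i ∉ L → j ∉ L → k ∉ L →
      (((s(i,j), L) ∈ G ∧ (s(i,k), insert j L) ∈ G) ↔
        ((s(i,k), L) ∈ G ∧ (s(i,j), insert k L) ∈ G)) ∧
      (((s(i,j), insert k L) ∈ G ∧ (s(i,k), insert j L) ∈ G) ↔
        ((s(i,j), L) ∈ G ∧ (s(i,k), L) ∈ G)) ∧
      (((s(i,j), L) ∈ G ∧ (s(i,j), insert k L) ∈ G) →
        ((s(i,k), L) ∈ G ∨ (s(j,k), L) ∈ G))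


/-- The conditioned embedding of a CI structure on `Nt` into the ground set `Nt ⊕ Lt`:
every conditioning set additionally contains all of `Lt`. -/
def condCI {Nt Lt : Type*} [DecidableEq Nt] [DecidableEq Lt] [Fintype Lt]
    (G : Set (CIStmt Nt)) : Set (CIStmt (Nt ⊕ Lt)) :=
  {t | ∃ i j : Nt, ∃ K : Finset Nt,
        (s(i, j), K) ∈ G ∧
        t = (s(Sum.inl i, Sum.inl j),
             K.map Function.Embedding.inl ∪
               (Finset.univ : Finset Lt).map Function.Embedding.inr)}


section helpers

open Matrix

def extM {M R : Type*} [DecidableEq M] [CommRing R] (Φ : Matrix M M R) (a : M → R) (lam c : R)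
    (l : M) : Matrix M M R :=
  Matrix.of fun x y => if x = l then (if y = l then lam else a y) else
    if y = l then a x else Φ x y + c * (a x * a y)

theorem extM_map {M R S : Type*} [DecidableEq M] [CommRing R] [CommRing S] (f : R →+* S)
    (Φ : Matrix M M R) (a : M → R) (lam c : R) (l : M) :
    (extM Φ a lam c l).map f = extM (Φ.map f) (fun x => f (a x)) (f lam) (f c) l := by
  ext x y
  simp only [extM, Matrix.map_apply, Matrix.of_apply]
  split_ifs <;> simp

theorem pminor_map {M R S : Type*} [DecidableEq M] [CommRing R] [CommRing S] (f : R →+* S)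
    (Φ : Matrix M M R) (K : Finset M) : pminor (Φ.map f) K = f (pminor Φ K) := by
  unfold pminor
  rw [RingHom.map_det]; rfl

theorem apminor_eq {M R : Type*} [DecidableEq M] [CommRing R]
    (Φ : Matrix M M R) (i j : M) (K : Finset M) :
    apminor Φ i j K = (Matrix.of fun a b : Unit ⊕ ↥K =>
      Φ (Sum.elim (fun _ => i) (fun k : K => (k : M)) a)
        (Sum.elim (fun _ => j) (fun k : K => (k : M)) b)).det := by
  unfold apminor
  congr 1
  ext x y
  rcases x with x | x <;> rcases y with y | y <;> rfl

noncomputable def mapEqv {A M : Type*} (e : A ↪ M) (K : Finset A) : ↥K ≃ ↥(K.map e) :=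
  Equiv.ofBijective (fun x => ⟨e x, Finset.mem_map_of_mem e x.2⟩) (by
    constructor
    · intro x y h
      exact Subtype.ext (e.injective (congrArg Subtype.val h))
    · rintro ⟨y, hy⟩
      obtain ⟨x, hx, rfl⟩ := Finset.mem_map.1 hy
      exact ⟨⟨x, hx⟩, rfl⟩)

theorem apminor_map {M R S : Type*} [DecidableEq M] [CommRing R] [CommRing S] (f : R →+* S)
    (Φ : Matrix M M R) (i j : M) (K : Finset M) :
    apminor (Φ.map f) i j K = f (apminor Φ i j K) := by
  simp only [apminor_eq]
  rw [RingHom.map_det]; rfl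

theorem apminor_symm {M R : Type*} [DecidableEq M] [CommRing R]
    (Φ : Matrix M M R) (h : Φ.IsSymm) (i j : M) (K : Finset M) :
    apminor Φ i j K = apminor Φ j i K := by
  simp only [apminor_eq]
  rw [← Matrix.det_transpose]
  congr 1
  ext a b
  simp only [Matrix.transpose_apply, Matrix.of_apply]
  exact h.apply _ _

theorem pminor_congr {M R : Type*} [DecidableEq M] [CommRing R]
    (Φ Ψ : Matrix M M R) (K : Finset M) (h : ∀ x ∈ K, ∀ y ∈ K, Φ x y = Ψ x y) :
    pminor Φ K = pminor Ψ K := by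
  unfold pminor
  congr 1
  ext a b
  exact h _ a.2 _ b.2

theorem apminor_congr {M R : Type*} [DecidableEq M] [CommRing R]
    (Φ Ψ : Matrix M M R) (i j : M) (K : Finset M)
    (h : ∀ x ∈ insert i K, ∀ y ∈ insert j K, Φ x y = Ψ x y) :
    apminor Φ i j K = apminor Ψ i j K := by
  simp only [apminor_eq]
  congr 1
  ext a b
  simp only [Matrix.of_apply]
  apply h
  · rcases a with a | a <;> simp
  · rcases b with b | b <;> simp

theorem det_ext {M F ι : Type*} [DecidableEq M] [Field F] [Fintype ι] [DecidableEq ι]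
    (Φ : Matrix M M F) (a : M → F) (lam : F) (hl : lam ≠ 0) (l : M) (f g : ι → M)
    (hf : ∀ x, f x ≠ l) (hg : ∀ x, g x ≠ l) :
    (Matrix.of fun x y : ι ⊕ Unit => extM Φ a lam lam⁻¹ l (Sum.elim f (fun _ => l) x)
      (Sum.elim g (fun _ => l) y)).det = lam * (Matrix.of fun x y => Φ (f x) (g y)).det := by
  have h1 : (Matrix.of fun x y : ι ⊕ Unit => extM Φ a lam lam⁻¹ l (Sum.elim f (fun _ => l) x)
      (Sum.elim g (fun _ => l) y)) = Matrix.fromBlocks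
        (Matrix.of fun x y => Φ (f x) (g y) + lam⁻¹ * (a (f x) * a (g y)))
        (Matrix.of fun x _ => a (f x)) (Matrix.of fun _ y => a (g y))
        (Matrix.of fun _ _ : Unit => lam) := by
    ext x y
    rcases x with x | x <;> rcases y with y | y <;> simp [extM, hf, hg]
  have h2 : (Matrix.of fun _ _ : Unit => lam) = lam • (1 : Matrix Unit Unit F) := by
    ext; simp
  rw [h1]
  have : Invertible (Matrix.of fun _ _ : Unit => lam) := by
    apply Matrix.invertibleOfIsUnitDet
    simp [hl]
  rw [Matrix.det_fromBlocks₂₂]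
  congr 1
  · simp
  · congr 1
    have h3 : ⅟(Matrix.of fun _ _ : Unit => lam) = Matrix.of fun _ _ : Unit => lam⁻¹ := by
      apply invOf_eq_right_inv
      ext
      simp [Matrix.mul_apply, hl]
    rw [h3]
    ext x y
    simp [Matrix.mul_apply]
    ring

theorem pminor_ext {M F : Type*} [DecidableEq M] [Field F]
    (Φ : Matrix M M F) (a : M → F) (lam : F) (hl : lam ≠ 0) (l : M) (K : Finset M) (hK : l ∉ K) :
    pminor (extM Φ a lam lam⁻¹ l) (insert l K) = lam * pminor Φ K := by
  have := det_ext Φ a lam hl l (fun x : K => (x : M)) (fun x : K => (x : M))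
    (fun x h => hK (h ▸ x.2)) (fun x h => hK (h ▸ x.2))
  unfold pminor
  refine Eq.trans ?_ this
  let φ : ↥K ⊕ Unit → ↥(insert l K) := Sum.elim (fun x => ⟨x, Finset.mem_insert_of_mem x.2⟩)
    (fun _ => ⟨l, Finset.mem_insert_self _ _⟩)
  have hφ : Function.Bijective φ := by
    constructor
    · rintro (x | x) (y | y) h
      · simp only [φ, Sum.elim_inl, Subtype.mk.injEq] at h
        rw [Subtype.ext h]
      · simp only [φ, Sum.elim_inl, Sum.elim_inr, Subtype.mk.injEq] at h
        exact absurd (h ▸ x.2) hK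
      · simp only [φ, Sum.elim_inl, Sum.elim_inr, Subtype.mk.injEq] at h
        exact absurd (h ▸ y.2) hK
      · rfl
    · rintro ⟨x, hx⟩
      rcases Finset.mem_insert.1 hx with h | h
      · exact ⟨Sum.inr (), by simp [φ, h]⟩
      · exact ⟨Sum.inl ⟨x, h⟩, by simp [φ]⟩
  rw [← Matrix.det_submatrix_equiv_self (Equiv.ofBijective φ hφ)]
  congr 1
  ext x y
  rcases x with x | x <;> rcases y with y | y <;> rfl

theorem apminor_ext {M F : Type*} [DecidableEq M] [Field F]
    (Φ : Matrix M M F) (a : M → F) (lam : F) (hl : lam ≠ 0) (l : M) (i j : M) (hi : i ≠ l)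
    (hj : j ≠ l) (K : Finset M) (hK : l ∉ K) :
    apminor (extM Φ a lam lam⁻¹ l) i j (insert l K) = lam * apminor Φ i j K := by
  have := det_ext Φ a lam hl l (Sum.elim (fun _ : Unit => i) (fun x : K => (x : M)))
    (Sum.elim (fun _ : Unit => j) (fun x : K => (x : M)))
    (by rintro (x | x); exacts [hi, fun h => hK (h ▸ x.2)])
    (by rintro (x | x); exacts [hj, fun h => hK (h ▸ x.2)])
  simp only [apminor_eq]
  refine Eq.trans ?_ this
  let φ : (Unit ⊕ ↥K) ⊕ Unit → Unit ⊕ ↥(insert l K) :=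
    Sum.elim (Sum.map id (fun x => ⟨x, Finset.mem_insert_of_mem x.2⟩))
    (fun _ => Sum.inr ⟨l, Finset.mem_insert_self _ _⟩)
  have hφ : Function.Bijective φ := by
    constructor
    · rintro ((x | x) | x) ((y | y) | y) h <;> simp [φ] at h
      · rfl
      · rw [h]
      · exact absurd (h ▸ x.2) hK
      · exact absurd (h ▸ y.2) hK
      · rfl
    · rintro (x | ⟨x, hx⟩)
      · exact ⟨Sum.inl (Sum.inl ()), rfl⟩
      rcases Finset.mem_insert.1 hx with h | h
      · exact ⟨Sum.inr (), by simp [φ, h]⟩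
      · exact ⟨Sum.inl (Sum.inr ⟨x, h⟩), by simp [φ]⟩
  rw [← Matrix.det_submatrix_equiv_self (Equiv.ofBijective φ hφ)]
  congr 1
  ext x y
  rcases x with (x | x) | x <;> rcases y with (y | y) | y <;> rfl

theorem extM_symm {M R : Type*} [DecidableEq M] [CommRing R] (Φ : Matrix M M R) (a : M → R)
    (lam c : R) (l : M) (h : Φ.IsSymm) : (extM Φ a lam c l).IsSymm := by
  ext x y
  simp only [extM, Matrix.transpose_apply, Matrix.of_apply, h.apply x y, mul_comm (a y) (a x)]
  split_ifs <;> rfl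

theorem generic_point {σ ι F : Type*} [Fintype σ] [Fintype ι] [Field F] [Infinite F]
    (T : σ → Set F) (hT : ∀ s, (T s).Infinite) (P : ι → MvPolynomial σ F) :
    ∃ a : σ → F, (∀ s, a s ∈ T s) ∧ ∀ i, P i ≠ 0 → MvPolynomial.eval a (P i) ≠ 0 := by
  classical
  by_contra! H
  have h0 : (∏ i ∈ Finset.univ.filter (fun i => P i ≠ 0), P i) ≠ 0 :=
    Finset.prod_ne_zero_iff.2 (fun i hi => (Finset.mem_filter.1 hi).2)
  apply h0
  apply MvPolynomial.funext_set T hT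
  intro a ha
  obtain ⟨i, hi, hi0⟩ := H a (fun s => ha s (Set.mem_univ s))
  rw [map_prod, map_zero]
  exact Finset.prod_eq_zero (Finset.mem_filter.2 ⟨Finset.mem_univ i, hi⟩) hi0

theorem generic_ext {M F : Type*} [Fintype M] [DecidableEq M] [Field F] [Infinite F]
    (T : M → Set F) (hT : ∀ s, (T s).Infinite) (Φ : Matrix M M F) (lam c : F) (l : M) :
    ∃ a : M → F, (∀ s, a s ∈ T s) ∧
      (∀ S, (∃ b, pminor (extM Φ b lam c l) S ≠ 0) → pminor (extM Φ a lam c l) S ≠ 0) ∧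
      (∀ i j K, (∃ b, apminor (extM Φ b lam c l) i j K ≠ 0) →
        apminor (extM Φ a lam c l) i j K ≠ 0) := by
  let Q : Matrix M M (MvPolynomial M F) := extM (Φ.map MvPolynomial.C) MvPolynomial.X
    (MvPolynomial.C lam) (MvPolynomial.C c) l
  have hQ : ∀ b, Q.map (MvPolynomial.eval b) = extM Φ b lam c l := by
    intro b
    rw [extM_map]
    congr 1
    · ext; simp
    · ext; simp
    · simp
    · simp
  obtain ⟨a, ha, h⟩ := generic_point T hT
    (Sum.elim (fun S : Finset M => pminor Q S)
      (fun t : M × M × Finset M => apminor Q t.1 t.2.1 t.2.2))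
  refine ⟨a, ha, ?_, ?_⟩
  · rintro S ⟨b, hb⟩
    have := h (Sum.inl S)
    simp only [Sum.elim_inl] at this
    rw [← pminor_map, hQ] at this
    refine this ?_
    intro h0
    rw [← hQ, pminor_map, h0, map_zero] at hb
    exact hb rfl
  · rintro i j K ⟨b, hb⟩
    have := h (Sum.inr (i, j, K))
    simp only [Sum.elim_inr] at this
    rw [← apminor_map, hQ] at this
    refine this ?_
    intro h0
    rw [← hQ, apminor_map, h0, map_zero] at hb
    exact hb rfl

theorem wit_p {M F : Type*} [DecidableEq M] [Field F] (Φ : Matrix M M F) (lam c : F) (l : M)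
    (S : Finset M) (hS : l ∉ S) (h : pminor Φ S ≠ 0) : ∃ b, pminor (extM Φ b lam c l) S ≠ 0 := by
  refine ⟨0, ?_⟩
  rwa [pminor_congr _ Φ]
  intro x hx y hy
  have h1 : x ≠ l := fun h => hS (h ▸ hx)
  have h2 : y ≠ l := fun h => hS (h ▸ hy)
  simp [extM, h1, h2]

theorem wit_l {M F : Type*} [DecidableEq M] [Field F] (Φ : Matrix M M F) (lam c : F) (l : M)
    (i : M) (K : Finset M) (hi : i ≠ l) (hiK : i ∉ K) (hK : l ∉ K) (h : pminor Φ K ≠ 0) :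
    ∃ b, apminor (extM Φ b lam c l) i l K ≠ 0 := by
  refine ⟨Pi.single i 1, ?_⟩
  have h1 : ∀ x : K, (x : M) ≠ l := fun x h => hK (h ▸ x.2)
  have h2 : ∀ x : K, (x : M) ≠ i := fun x h => hiK (h ▸ x.2)
  have : apminor (extM Φ (Pi.single i 1) lam c l) i l K = pminor Φ K := by
    rw [apminor_eq]; unfold pminor
    have e : (Matrix.of fun a b : Unit ⊕ ↥K =>
      (extM Φ (Pi.single i 1) lam c l) (Sum.elim (fun _ => i) (fun k : K => (k : M)) a)
        (Sum.elim (fun _ => l) (fun k : K => (k : M)) b)) = Matrix.fromBlocks (1 : Matrix Unit Unit F)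
          (Matrix.of fun _ (y : K) => Φ i y) 0
          (Φ.submatrix (fun a : K => (a : M)) (fun a : K => (a : M))) := by
      ext x y
      rcases x with x | x <;> rcases y with y | y <;> simp [extM, h1, h2, hi]
    rw [e, Matrix.det_fromBlocks_zero₂₁]
    simp
  rwa [this]

theorem wit_n {M F : Type*} [DecidableEq M] [Field F] (Φ : Matrix M M F) (lam c : F) (hc : c ≠ 0)
    (l : M) (i j : M) (K : Finset M) (hi : i ≠ l) (hj : j ≠ l) (hij : i ≠ j)
    (hiK : i ∉ K) (hjK : j ∉ K) (hK : l ∉ K) (h : pminor Φ K ≠ 0) :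
    ∃ b, apminor (extM Φ b lam c l) i j K ≠ 0 := by
  have h1 : ∀ x : K, (x : M) ≠ l := fun x h => hK (h ▸ x.2)
  have h2 : ∀ x : K, (x : M) ≠ i := fun x h => hiK (h ▸ x.2)
  have h3 : ∀ x : K, (x : M) ≠ j := fun x h => hjK (h ▸ x.2)
  let D := Φ.submatrix (fun a : K => (a : M)) (fun a : K => (a : M))
  have key : ∀ t : F, apminor (extM Φ (Pi.single i 1 + Pi.single j t) lam c l) i j K =
      apminor Φ i j K + pminor Φ K * (c * t) := by
    intro t
    have e : (Matrix.of fun a b : Unit ⊕ ↥K =>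
      (extM Φ (Pi.single i 1 + Pi.single j t) lam c l) (Sum.elim (fun _ => i) (fun k : K => (k : M)) a)
        (Sum.elim (fun _ => j) (fun k : K => (k : M)) b)) = Matrix.fromBlocks
          (Matrix.of fun _ _ : Unit => Φ i j + c * t)
          (Matrix.of fun _ (y : K) => Φ i y) (Matrix.of fun (x : K) _ => Φ x j) D := by
      ext x y
      rcases x with x | x <;> rcases y with y | y <;>
        simp [extM, h1, h2, h3, hi, hj, hij, hij.symm, D]
    have e' : (Matrix.of fun a b : Unit ⊕ ↥K =>
      Φ (Sum.elim (fun _ => i) (fun k : K => (k : M)) a)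
        (Sum.elim (fun _ => j) (fun k : K => (k : M)) b)) = Matrix.fromBlocks
          (Matrix.of fun _ _ : Unit => Φ i j)
          (Matrix.of fun _ (y : K) => Φ i y) (Matrix.of fun (x : K) _ => Φ x j) D := by
      ext x y
      rcases x with x | x <;> rcases y with y | y <;> simp [D]
    have : Invertible D := Matrix.invertibleOfIsUnitDet _ (isUnit_iff_ne_zero.2 h)
    simp only [apminor_eq]
    rw [e, e', Matrix.det_fromBlocks₂₂, Matrix.det_fromBlocks₂₂]
    change D.det * _ = D.det * _ + D.det * _
    rw [← mul_add]
    congr 1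
    simp
    ring
  by_cases h0 : apminor Φ i j K = 0
  · refine ⟨Pi.single i 1 + Pi.single j 1, ?_⟩
    · rw [key 1, h0]
      simp [h, hc]
  · refine ⟨Pi.single i 1 + Pi.single j 0, ?_⟩
    · rw [key 0]
      simpa using h0

/-- partial solution of the problem on the active set `D ∪ W` -/
def Good {M F : Type*} [DecidableEq M] [Field F] (Γ : Matrix M M F) (D W : Finset M)
    (Φ : Matrix M M F) : Prop :=
  Φ.IsSymm ∧ (∀ S ⊆ D ∪ W, pminor Φ S ≠ 0) ∧
  ∀ i ∈ D ∪ W, ∀ j ∈ D ∪ W, ∀ K ⊆ D ∪ W, i ≠ j → i ∉ K → j ∉ K →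
    (apminor Φ i j K = 0 ↔ i ∈ D ∧ j ∈ D ∧ W ⊆ K ∧ apminor Γ i j (K \ W) = 0)

theorem step {M F : Type*} [Fintype M] [DecidableEq M] [Field F] [Infinite F]
    (T : M → Set F) (hT : ∀ s, (T s).Infinite) (Γ : Matrix M M F) (D W : Finset M)
    (Φ : Matrix M M F) (hΦ : Good Γ D W Φ) (lam : F) (hl : lam ≠ 0) (l : M) (hlD : l ∉ D)
    (hlW : l ∉ W) :
    ∃ a : M → F, (∀ s, a s ∈ T s) ∧ Good Γ D (insert l W) (extM Φ a lam lam⁻¹ l) := by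
  obtain ⟨hs, hp, hap⟩ := hΦ
  obtain ⟨a, ha, h1, h2⟩ := generic_ext T hT Φ lam lam⁻¹ l
  have hsym := extM_symm Φ a lam lam⁻¹ l hs
  have red : ∀ S : Finset M, S ⊆ D ∪ insert l W → S.erase l ⊆ D ∪ W := by
    intro S hS x hx
    have := hS (Finset.mem_of_mem_erase hx)
    have := Finset.ne_of_mem_erase hx
    grind
  have red' : ∀ x, x ∈ D ∪ insert l W → x ≠ l → x ∈ D ∪ W := by grind
  refine ⟨a, ha, hsym, ?_, ?_⟩
  · intro S hS
    by_cases hlS : l ∈ S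
    · rw [← Finset.insert_erase hlS, pminor_ext _ _ _ hl _ _ (Finset.notMem_erase l S)]
      exact mul_ne_zero hl (hp _ (red S hS))
    · apply h1
      apply wit_p _ _ _ _ _ hlS
      have := hp _ (red S hS)
      rwa [Finset.erase_eq_of_notMem hlS] at this
  · intro i hi j hj K hK hij hiK hjK
    have hKr := red K hK
    by_cases hlK : l ∈ K
    · have hil : i ≠ l := fun h => hiK (h ▸ hlK)
      have hjl : j ≠ l := fun h => hjK (h ▸ hlK)
      have e : apminor (extM Φ a lam lam⁻¹ l) i j K = lam * apminor Φ i j (K.erase l) := by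
        conv_lhs => rw [← Finset.insert_erase hlK]
        exact apminor_ext _ _ _ hl _ _ _ hil hjl _ (Finset.notMem_erase l K)
      rw [e, mul_eq_zero, or_iff_right hl,
        hap i (red' i hi hil) j (red' j hj hjl) _ hKr hij (by grind) (by grind)]
      have e1 : K \ insert l W = K.erase l \ W := by grind
      have e2 : insert l W ⊆ K ↔ W ⊆ K.erase l := by grind
      rw [e1, e2]
    · rw [Finset.erase_eq_of_notMem hlK] at hKr
      have hpK := hp K hKr
      have hne : apminor (extM Φ a lam lam⁻¹ l) i j K ≠ 0 := by
        by_cases hil : i = l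
        · subst hil
          rw [apminor_symm _ hsym]
          exact h2 _ _ _ (wit_l _ _ _ _ _ _ hij.symm hjK hlK hpK)
        · by_cases hjl : j = l
          · subst hjl
            exact h2 _ _ _ (wit_l _ _ _ _ _ _ hij hiK hlK hpK)
          · exact h2 _ _ _ (wit_n _ _ _ (inv_ne_zero hl) _ _ _ _ hil hjl hij hiK hjK hlK hpK)
      refine ⟨fun h => absurd h hne, fun h => absurd (h.2.2.1 (Finset.mem_insert_self l W)) hlK⟩

theorem ind1 {M F : Type*} [Fintype M] [DecidableEq M] [Field F] [Infinite F]
    (Γ : Matrix M M F) (D : Finset M) (h0 : Good Γ D ∅ Γ) (W : Finset M) (hW : Disjoint D W) :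
    ∃ Φ, Good Γ D W Φ := by
  induction W using Finset.induction_on with
  | empty => exact ⟨Γ, h0⟩
  | insert l W hl ih =>
    rw [Finset.disjoint_insert_right] at hW
    obtain ⟨Φ, hΦ⟩ := ih hW.2
    obtain ⟨a, -, h⟩ := step (fun _ => Set.univ) (fun _ => Set.infinite_univ) Γ D W Φ hΦ 1
      one_ne_zero l hW.1 hl
    exact ⟨_, h⟩

theorem ind2 {M F : Type*} [Fintype M] [DecidableEq M] [Field F] [LinearOrder F]
    [IsStrictOrderedRing F]
    (Γ : Matrix M M F) (D : Finset M) (h0 : Good Γ D ∅ Γ) (W : Finset M) (hW : Disjoint D W) :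
    ∀ (B : Matrix M M F), B.IsSymm → (∀ x ∈ D, ∀ y ∈ D, B x y = Γ x y) →
    (∀ x ∈ D, ∀ y ∈ W, B x y = 0) → (∀ S ⊆ W, pminor B S ≠ 0) → ∀ ε : F, 0 < ε →
    ∃ Φ, Good Γ D W Φ ∧ ∀ x ∈ D ∪ W, ∀ y ∈ D ∪ W, |Φ x y - B x y| < ε := by
  induction W using Finset.induction_on with
  | empty =>
    intro B hB hD _ _ ε hε
    refine ⟨Γ, h0, ?_⟩
    intro x hx y hy
    rw [hD x (by simpa using hx) y (by simpa using hy)]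
    simpa using hε
  | insert l W hl ih =>
    rw [Finset.disjoint_insert_right] at hW
    intro B hB hD hDW hp ε hε
    have hlam : B l l ≠ 0 := by
      have := hp {l} (by simp)
      simpa [pminor] using this
    let B' : Matrix M M F := Matrix.of fun x y => B x y - (B l l)⁻¹ * (B x l * B y l)
    have hBl : ∀ x ∈ D, B x l = 0 := fun x hx => hDW x hx l (Finset.mem_insert_self _ _)
    have hBB : extM B' (fun x => B x l) (B l l) (B l l)⁻¹ l = B := by
      ext x y
      simp only [extM, B', Matrix.of_apply]
      split_ifs with h1 h2 h2
      · rw [h1, h2]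
      · rw [h1, hB.apply]
      · rw [h2]
      · ring
    obtain ⟨Φ, hΦ, hcl⟩ := ih hW.2 B' (by
        ext x y
        simp only [B', Matrix.transpose_apply, Matrix.of_apply, hB.apply x y]
        ring) (by
        intro x hx y hy
        simp [B', hD x hx y hy, hBl x hx]) (by
        intro x hx y hy
        simp [B', hDW x hx y (Finset.mem_insert_of_mem hy), hBl x hx]) (by
        intro S hS h
        have := pminor_ext B' (fun x => B x l) (B l l) hlam l S (fun h => hl (hS h))
        rw [hBB, h, mul_zero] at this
        exact hp _ (Finset.insert_subset_insert l hS) this) (ε / 2) (half_pos hε)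
    let C : F := ∑ x, |B x l|
    have hC : ∀ x, |B x l| ≤ C := fun x =>
      Finset.single_le_sum (f := fun x => |B x l|) (fun _ _ => abs_nonneg _) (Finset.mem_univ x)
    have hC0 : 0 ≤ C := Finset.sum_nonneg (fun _ _ => abs_nonneg _)
    have hlpos : 0 < |B l l| := abs_pos.2 hlam
    let η : F := min (min 1 ε) (ε / 2 * |B l l| / (2 * C + 1) / 2)
    have hη : 0 < η := by
      refine lt_min (lt_min one_pos hε) ?_
      positivity
    have hη1 : η ≤ 1 := (min_le_left _ _).trans (min_le_left _ _)
    have hηε : η ≤ ε := (min_le_left _ _).trans (min_le_right _ _)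
    have hη2 : η * (2 * C + 1) < ε / 2 * |B l l| := by
      have h1 : η ≤ ε / 2 * |B l l| / (2 * C + 1) / 2 := min_le_right _ _
      have h2 : 0 < 2 * C + 1 := by linarith
      have h3 : 0 < ε / 2 * |B l l| := by positivity
      calc η * (2 * C + 1) ≤ ε / 2 * |B l l| / (2 * C + 1) / 2 * (2 * C + 1) := by gcongr
        _ = ε / 2 * |B l l| / 2 := by field_simp
        _ < _ := half_lt_self h3
    obtain ⟨a, ha, hg⟩ := step (fun x => Set.Ioo (B x l - η) (B x l + η))
      (fun x => Set.Ioo_infinite (by linarith)) Γ D W Φ hΦ (B l l) hlam l hW.1 hl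
    have hab : ∀ x, |a x - B x l| < η := fun x => by
      have := ha x
      rw [abs_lt]
      constructor <;> linarith [this.1, this.2]
    refine ⟨_, hg, ?_⟩
    intro x hx y hy
    have hBxy := congrFun (congrFun hBB x) y
    rw [← hBxy]
    simp only [extM, Matrix.of_apply]
    by_cases h1 : x = l
    · by_cases h2 : y = l
      · simpa [h1, h2, hlam] using hε
      · simp only [h1, h2, if_true, if_false]
        exact (hab y).trans_le hηε
    · by_cases h2 : y = l
      · simp only [h1, h2, if_true, if_false]
        exact (hab x).trans_le hηε
      · simp only [h1, h2, if_false]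
        have hc := hcl x (by grind) y (by grind)
        have e : Φ x y + (B l l)⁻¹ * (a x * a y) - (B' x y + (B l l)⁻¹ * (B x l * B y l)) =
          (Φ x y - B' x y) + (B l l)⁻¹ * ((a x - B x l) * (a y - B y l) +
            (a x - B x l) * B y l + B x l * (a y - B y l)) := by ring
        rw [e]
        have hx' := (hab x).le
        have hy' := (hab y).le
        have b1 : |(a x - B x l) * (a y - B y l) +
            (a x - B x l) * B y l + B x l * (a y - B y l)| ≤ η * (2 * C + 1) := by
          refine (abs_add_three _ _ _).trans ?_
          rw [abs_mul, abs_mul, abs_mul]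
          have := mul_le_mul hx' (hy'.trans hη1) (abs_nonneg _) hη.le
          have := mul_le_mul hx' (hC y) (abs_nonneg _) hη.le
          have := mul_le_mul (hC x) hy' (abs_nonneg _) hC0
          linarith
        refine (abs_add_le _ _).trans_lt ?_
        have b2 : |(B l l)⁻¹ * ((a x - B x l) * (a y - B y l) +
            (a x - B x l) * B y l + B x l * (a y - B y l))| < ε / 2 := by
          rw [abs_mul, abs_inv, inv_mul_lt_iff₀ hlpos, mul_comm |B l l|]
          exact b1.trans_lt hη2
        linarith

theorem mem_CIS {M R : Type*} [DecidableEq M] [CommRing R] (Φ : Matrix M M R) (h : Φ.IsSymm)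
    (i j : M) (K : Finset M) :
    ((s(i, j), K) : CIStmt M) ∈ CIS Φ ↔ i ≠ j ∧ i ∉ K ∧ j ∉ K ∧ apminor Φ i j K = 0 := by
  simp only [CIS, CIStmt.proper, Set.mem_ofPred_eq, Sym2.mk_isDiag_iff, Sym2.mem_iff]
  constructor
  · rintro ⟨⟨h1, h2⟩, h3⟩
    exact ⟨h1, h2 i (Or.inl rfl), h2 j (Or.inr rfl), h3 i j rfl⟩
  · rintro ⟨h1, h2, h3, h4⟩
    refine ⟨⟨h1, ?_⟩, ?_⟩
    · rintro x (rfl | rfl) <;> assumption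
    · intro a b hab
      rcases Sym2.eq_iff.1 hab with ⟨rfl, rfl⟩ | ⟨rfl, rfl⟩
      · exact h4
      · rwa [apminor_symm _ h]

theorem pminor_emb {A M R : Type*} [DecidableEq A] [DecidableEq M] [CommRing R] (e : A ↪ M)
    (Φ : Matrix M M R) (K : Finset A) :
    pminor Φ (K.map e) = pminor (Φ.submatrix e e) K := by
  unfold pminor
  rw [← Matrix.det_submatrix_equiv_self (mapEqv e K)]
  rfl

theorem apminor_emb {A M R : Type*} [DecidableEq A] [DecidableEq M] [CommRing R] (e : A ↪ M)
    (Φ : Matrix M M R) (i j : A) (K : Finset A) :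
    apminor Φ (e i) (e j) (K.map e) = apminor (Φ.submatrix e e) i j K := by
  simp only [apminor_eq]
  rw [← Matrix.det_submatrix_equiv_self (Equiv.sumCongr (Equiv.refl Unit) (mapEqv e K))]
  congr 1
  ext x y
  rcases x with x | x <;> rcases y with y | y <;> rfl

theorem good_init {A L F : Type*} [Fintype A] [DecidableEq A] [DecidableEq L]
    [Field F] (Γ : Matrix A A F) (Λ : Matrix L L F) (h : Γ.IsSymm) (hΛ : Λ.IsSymm)
    (hp : PrinReg Γ) : Good (Matrix.fromBlocks Γ 0 0 Λ)
      ((Finset.univ : Finset A).map Function.Embedding.inl) ∅ (Matrix.fromBlocks Γ 0 0 Λ) := by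
  refine ⟨?_, ?_, ?_⟩
  · exact Matrix.IsSymm.fromBlocks h (by simp) hΛ
  · intro S hS
    rw [Finset.union_empty] at hS
    obtain ⟨K, -, rfl⟩ := Finset.subset_map_iff.1 hS
    rw [pminor_emb]
    exact hp K
  · intro i hi j hj K hK _ _ _
    simp only [Finset.union_empty] at hi hj
    simp [hi, hj]

theorem good_final {A L F : Type*} [Fintype A] [DecidableEq A] [Fintype L] [DecidableEq L]
    [Field F] (Γ : Matrix A A F) (Λ : Matrix L L F) (h : Γ.IsSymm)
    (Φ : Matrix (A ⊕ L) (A ⊕ L) F) (hg : Good (Matrix.fromBlocks Γ 0 0 Λ)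
      ((Finset.univ : Finset A).map Function.Embedding.inl)
      ((Finset.univ : Finset L).map Function.Embedding.inr) Φ) :
    Φ.IsSymm ∧ PrinReg Φ ∧ CIS Φ = condCI (CIS Γ) := by
  obtain ⟨hs, hp, hap⟩ := hg
  have hall : ∀ x : A ⊕ L, x ∈ (Finset.univ : Finset A).map Function.Embedding.inl ∪
      (Finset.univ : Finset L).map Function.Embedding.inr := by
    rintro (x | x) <;> simp
  refine ⟨hs, fun S => hp S (fun x _ => hall x), ?_⟩
  have hsub : ∀ (i j : A) (K : Finset A), apminor (Matrix.fromBlocks Γ 0 0 Λ) (Sum.inl i)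
      (Sum.inl j) (K.map Function.Embedding.inl) = apminor Γ i j K := fun i j K =>
    apminor_emb (Function.Embedding.inl : A ↪ A ⊕ L) _ i j K
  have hdiff : ∀ K : Finset A, (K.map Function.Embedding.inl ∪
               (Finset.univ : Finset L).map Function.Embedding.inr) \
               (Finset.univ : Finset L).map Function.Embedding.inr =
               K.map Function.Embedding.inl := by
    intro K
    ext (x | x) <;> simp
  ext ⟨z, K⟩
  induction z using Sym2.inductionOn with
  | hf i j =>
  rw [mem_CIS _ hs]
  constructor
  · rintro ⟨hij, hi, hj, h0⟩
    obtain ⟨hiD, hjD, hWK, h0'⟩ := (hap i (hall i) j (hall j) K (fun x _ => hall x) hij hi hj).1 h0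
    obtain ⟨i, -, rfl⟩ := Finset.mem_map.1 hiD
    obtain ⟨j, -, rfl⟩ := Finset.mem_map.1 hjD
    have : K \ (Finset.univ : Finset L).map Function.Embedding.inr ⊆
        (Finset.univ : Finset A).map Function.Embedding.inl := by
      rintro (x | x) <;> simp
    obtain ⟨K', -, hK'⟩ := Finset.subset_map_iff.1 this
    have hKK : K = K'.map Function.Embedding.inl ∪
               (Finset.univ : Finset L).map Function.Embedding.inr := by
      rw [← hK', Finset.sdiff_union_of_subset hWK]
    refine ⟨i, j, K', ?_, by rw [hKK]; rfl⟩
    rw [mem_CIS _ h]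
    rw [hK'] at h0'
    refine ⟨fun h => hij (by rw [h]), fun h => hi ?_, fun h => hj ?_, ?_⟩
    · rw [hKK]; simpa using h
    · rw [hKK]; simpa using h
    · rw [← hsub]; exact h0'
  · rintro ⟨i', j', K', hmem, heq⟩
    rw [← mem_CIS _ hs, heq, mem_CIS _ hs]
    rw [mem_CIS _ h] at hmem
    obtain ⟨h1, h2, h3, h4⟩ := hmem
    have g1 : (Sum.inl i' : A ⊕ L) ≠ Sum.inl j' := by simpa using h1
    have g2 : (Sum.inl i' : A ⊕ L) ∉ K'.map Function.Embedding.inl ∪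
               (Finset.univ : Finset L).map Function.Embedding.inr := by simpa using h2
    have g3 : (Sum.inl j' : A ⊕ L) ∉ K'.map Function.Embedding.inl ∪
               (Finset.univ : Finset L).map Function.Embedding.inr := by simpa using h3
    refine ⟨g1, g2, g3, ?_⟩
    rw [hap _ (hall _) _ (hall _) _ (fun x _ => hall x) g1 g2 g3]
    refine ⟨by simp, by simp, Finset.subset_union_right, ?_⟩
    rw [hdiff, hsub, h4]

theorem disj_aux {A L : Type*} [Fintype A] [Fintype L] :
    Disjoint ((Finset.univ : Finset A).map (Function.Embedding.inl : A ↪ A ⊕ L))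
      ((Finset.univ : Finset L).map Function.Embedding.inr) := by
  rw [Finset.disjoint_left]
  rintro (x | x) <;> simp

end helpers

universe u v w

/-- a CI structure algebraically realizable on `Nt` remains algebraically
realizable on `Nt ⊕ Lt` after adjoining `Lt` to every conditioning set; over an ordered
field the realization can be chosen close to a block-diagonal matrix with arbitrary
principally regular second block. -/
theorem stmt9 :
    (∀ (𝕂 : Type u) [Field 𝕂] [Infinite 𝕂],
     ∀ (Nt : Type v) (Lt : Type w) [Fintype Nt] [DecidableEq Nt] [Fintype Lt] [DecidableEq Lt]
       (Γ : Matrix Nt Nt 𝕂), Γ.IsSymm → PrinReg Γ →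
       ∃ Φ : Matrix (Nt ⊕ Lt) (Nt ⊕ Lt) 𝕂,
         Φ.IsSymm ∧ PrinReg Φ ∧ CIS Φ = condCI (CIS Γ)) ∧
    (∀ (𝕂 : Type u) [Field 𝕂] [LinearOrder 𝕂] [IsStrictOrderedRing 𝕂],
     ∀ (Nt : Type v) (Lt : Type w) [Fintype Nt] [DecidableEq Nt] [Fintype Lt] [DecidableEq Lt]
       (Γ : Matrix Nt Nt 𝕂) (Λ : Matrix Lt Lt 𝕂),
       Γ.IsSymm → PrinReg Γ → Λ.IsSymm → PrinReg Λ →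
       ∀ ε : 𝕂, 0 < ε →
         ∃ Φ : Matrix (Nt ⊕ Lt) (Nt ⊕ Lt) 𝕂,
           Φ.IsSymm ∧ PrinReg Φ ∧ CIS Φ = condCI (CIS Γ) ∧
           ∀ a b : Nt ⊕ Lt, |Φ a b - Matrix.fromBlocks Γ 0 0 Λ a b| < ε) := by
  constructor
  · intro 𝕂 _ _ Nt Lt _ _ _ _ Γ hΓ hp
    obtain ⟨Φ, hΦ⟩ := ind1 _ _ (good_init (L := Lt) Γ 1 hΓ Matrix.isSymm_one hp) _ disj_aux
    exact ⟨Φ, good_final Γ 1 hΓ Φ hΦ⟩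
  · intro 𝕂 _ _ _ Nt Lt _ _ _ _ Γ Λ hΓ hp hΛ hpΛ ε hε
    have hsub : ∀ K : Finset Lt, pminor (Matrix.fromBlocks Γ 0 0 Λ)
        (K.map (Function.Embedding.inr : Lt ↪ Nt ⊕ Lt)) = pminor Λ K := fun K =>
      pminor_emb (Function.Embedding.inr : Lt ↪ Nt ⊕ Lt) _ K
    obtain ⟨Φ, hΦ, hc⟩ := ind2 _ _ (good_init Γ Λ hΓ hΛ hp) _ disj_aux
      (Matrix.fromBlocks Γ 0 0 Λ) (good_init Γ Λ hΓ hΛ hp).1 (fun _ _ _ _ => rfl)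
      (by
        intro x hx y hy
        obtain ⟨x, -, rfl⟩ := Finset.mem_map.1 hx
        obtain ⟨y, -, rfl⟩ := Finset.mem_map.1 hy
        rfl)
      (by
        intro S hS
        obtain ⟨K, -, rfl⟩ := Finset.subset_map_iff.1 hS
        rw [hsub]
        exact hpΛ K) ε hε
    obtain ⟨h1, h2, h3⟩ := good_final Γ Λ hΓ Φ hΦ
    refine ⟨Φ, h1, h2, h3, fun a b => hc a ?_ b ?_⟩
    · rcases a with a | a <;> simp
    · rcases b with b | b <;> simp
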